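/- arXiv:1504.01960 — 3 statements merged into one kernel-verified Lean document; each statement's English description precedes it below -/
import Mathlib

section
/- Let M be an abelian group with an involution σ, let N = 1 + σ and D = 1 − σ. Then the map sending N(x) to D(x) induces a well-defined group isomorphism from N(M)/2·M^σ onto D(M)/2·ker(N). In particular, if the Tate cohomology groups Ĥ⁰ = M^σ/N(M) and H¹ = ker(N)/D(M) are finite, they have the same cardinality whenever M^σ/2M^σ and ker(N)/2ker(N) are finite of equal cardinality. -/
/-- The doubling homomorphism `x ↦ 2 • x` of an abelian group. -/
def dbl (M : Type*) [AddCommGroup M] : M →+ M :=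
  AddMonoidHom.mk' (fun x => (2 : ℤ) • x) (fun a b => smul_add (2 : ℤ) a b)

/-- Two homomorphisms out of `M` under which `P` and `Q` have the same preimage induce an
isomorphism between the quotients of their ranges by `P` and `Q`. -/
theorem exists_addEquiv_range_quotient {M A B : Type*} [AddCommGroup M] [AddCommGroup A]
    [AddCommGroup B] (f : M →+ A) (g : M →+ B) (P : AddSubgroup A) (Q : AddSubgroup B)
    (h : ∀ x, f x ∈ P ↔ g x ∈ Q) :
    ∃ e : (f.range ⧸ P.addSubgroupOf f.range) ≃+ (g.range ⧸ Q.addSubgroupOf g.range),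
      ∀ x : M, e (QuotientAddGroup.mk ⟨f x, AddMonoidHom.mem_range.mpr ⟨x, rfl⟩⟩) =
        QuotientAddGroup.mk ⟨g x, AddMonoidHom.mem_range.mpr ⟨x, rfl⟩⟩ := by
  let φ := (QuotientAddGroup.mk' (P.addSubgroupOf f.range)).comp f.rangeRestrict
  let ψ := (QuotientAddGroup.mk' (Q.addSubgroupOf g.range)).comp g.rangeRestrict
  have hφ : Function.Surjective φ :=
    (QuotientAddGroup.mk'_surjective _).comp f.rangeRestrict_surjective
  have hψ : Function.Surjective ψ :=
    (QuotientAddGroup.mk'_surjective _).comp g.rangeRestrict_surjective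
  have hker : φ.ker = ψ.ker := by
    ext x
    simpa [φ, ψ, AddMonoidHom.mem_ker, QuotientAddGroup.eq_zero_iff,
      AddSubgroup.mem_addSubgroupOf] using h x
  let eφ := QuotientAddGroup.quotientKerEquivOfSurjective φ hφ
  let eψ := QuotientAddGroup.quotientKerEquivOfSurjective ψ hψ
  refine ⟨(eφ.symm.trans (QuotientAddGroup.quotientAddEquivOfEq hker)).trans eψ, fun x => ?_⟩
  have hx : eφ.symm (φ x) = (x : M ⧸ φ.ker) := eφ.symm_apply_eq.mpr rfl
  change eψ (QuotientAddGroup.quotientAddEquivOfEq hker (eφ.symm (φ x))) = ψ x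
  rw [hx]
  rfl

/-- The norm `x + σ x` is twice a fixed point exactly when `x - σ x` is twice an element of norm zero. -/
theorem norm_mem_dbl_fixed_iff {M : Type*} [AddCommGroup M] (σ : M ≃+ M) (x : M) :
    (AddMonoidHom.id M + (σ : M →+ M)) x ∈
        AddSubgroup.map (dbl M) (AddMonoidHom.ker (AddMonoidHom.id M - (σ : M →+ M))) ↔
      (AddMonoidHom.id M - (σ : M →+ M)) x ∈
        AddSubgroup.map (dbl M) (AddMonoidHom.ker (AddMonoidHom.id M + (σ : M →+ M))) := by
  simp only [AddSubgroup.mem_map, AddMonoidHom.mem_ker, dbl, AddMonoidHom.mk'_apply,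
    AddMonoidHom.add_apply, AddMonoidHom.sub_apply, AddMonoidHom.id_apply,
    AddMonoidHom.coe_coe]
  constructor
  all_goals
    rintro ⟨y, hy, hxy⟩
    refine ⟨x - y, ?_, ?_⟩
    · rw [map_sub]
      grind
    · grind

theorem map_dbl_fixed_le_range {M : Type*} [AddCommGroup M] (σ : M ≃+ M) :
    AddSubgroup.map (dbl M) (AddMonoidHom.ker (AddMonoidHom.id M - (σ : M →+ M))) ≤
      AddMonoidHom.range (AddMonoidHom.id M + (σ : M →+ M)) := by
  rintro _ ⟨y, hy, rfl⟩
  have hy' : y - σ y = 0 := hy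
  refine ⟨y, ?_⟩
  change y + σ y = (2 : ℤ) • y
  grind

theorem map_dbl_ker_norm_le_range {M : Type*} [AddCommGroup M] (σ : M ≃+ M) :
    AddSubgroup.map (dbl M) (AddMonoidHom.ker (AddMonoidHom.id M + (σ : M →+ M))) ≤
      AddMonoidHom.range (AddMonoidHom.id M - (σ : M →+ M)) := by
  rintro _ ⟨y, hy, rfl⟩
  have hy' : y + σ y = 0 := hy
  refine ⟨y, ?_⟩
  change y - σ y = (2 : ℤ) • y
  grind

theorem range_norm_le_fixed {M : Type*} [AddCommGroup M] (σ : M ≃+ M)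
    (hσ : ∀ x, σ (σ x) = x) :
    AddMonoidHom.range (AddMonoidHom.id M + (σ : M →+ M)) ≤
      AddMonoidHom.ker (AddMonoidHom.id M - (σ : M →+ M)) := by
  rintro _ ⟨y, rfl⟩
  change (y + σ y) - σ (y + σ y) = 0
  rw [map_add, hσ]
  abel

theorem range_sub_le_ker_norm {M : Type*} [AddCommGroup M] (σ : M ≃+ M)
    (hσ : ∀ x, σ (σ x) = x) :
    AddMonoidHom.range (AddMonoidHom.id M - (σ : M →+ M)) ≤
      AddMonoidHom.ker (AddMonoidHom.id M + (σ : M →+ M)) := by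
  rintro _ ⟨y, rfl⟩
  change (y - σ y) + σ (y - σ y) = 0
  rw [map_sub, hσ]
  abel

/-- For an involution `σ` of an abelian group `M`, with `N = 1 + σ`, `D = 1 - σ`,
`M^σ = ker D` and `ker N`, the map `N(x) ↦ D(x)` induces a well-defined group
isomorphism `N(M)/2·M^σ ≃ D(M)/2·ker N`.  In particular, if the Tate cohomology groups
`Ĥ⁰ = M^σ/N(M)` and `H¹ = ker N/D(M)` are finite, they have the same cardinality
whenever `M^σ/2M^σ` and `ker N/2 ker N` are finite of equal cardinality. -/
theorem stmt_2 {M : Type*} [AddCommGroup M] (σ : M ≃+ M) (hσ : ∀ x, σ (σ x) = x) :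
    (∃ e : (AddMonoidHom.range (AddMonoidHom.id M + (σ : M →+ M)) ⧸
            ((AddSubgroup.map (dbl M)
                (AddMonoidHom.ker (AddMonoidHom.id M - (σ : M →+ M)))).addSubgroupOf
              (AddMonoidHom.range (AddMonoidHom.id M + (σ : M →+ M))))) ≃+
          (AddMonoidHom.range (AddMonoidHom.id M - (σ : M →+ M)) ⧸
            ((AddSubgroup.map (dbl M)
                (AddMonoidHom.ker (AddMonoidHom.id M + (σ : M →+ M)))).addSubgroupOf
              (AddMonoidHom.range (AddMonoidHom.id M - (σ : M →+ M))))),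
      ∀ x : M,
        e (QuotientAddGroup.mk
            ⟨(AddMonoidHom.id M + (σ : M →+ M)) x, AddMonoidHom.mem_range.mpr ⟨x, rfl⟩⟩) =
          QuotientAddGroup.mk
            ⟨(AddMonoidHom.id M - (σ : M →+ M)) x, AddMonoidHom.mem_range.mpr ⟨x, rfl⟩⟩) ∧
    (Finite (AddMonoidHom.ker (AddMonoidHom.id M - (σ : M →+ M)) ⧸
        ((AddMonoidHom.range (AddMonoidHom.id M + (σ : M →+ M))).addSubgroupOf
          (AddMonoidHom.ker (AddMonoidHom.id M - (σ : M →+ M))))) →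
      Finite (AddMonoidHom.ker (AddMonoidHom.id M + (σ : M →+ M)) ⧸
        ((AddMonoidHom.range (AddMonoidHom.id M - (σ : M →+ M))).addSubgroupOf
          (AddMonoidHom.ker (AddMonoidHom.id M + (σ : M →+ M))))) →
      Finite (AddMonoidHom.ker (AddMonoidHom.id M - (σ : M →+ M)) ⧸
        ((AddSubgroup.map (dbl M)
            (AddMonoidHom.ker (AddMonoidHom.id M - (σ : M →+ M)))).addSubgroupOf
          (AddMonoidHom.ker (AddMonoidHom.id M - (σ : M →+ M))))) →
      Finite (AddMonoidHom.ker (AddMonoidHom.id M + (σ : M →+ M)) ⧸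
        ((AddSubgroup.map (dbl M)
            (AddMonoidHom.ker (AddMonoidHom.id M + (σ : M →+ M)))).addSubgroupOf
          (AddMonoidHom.ker (AddMonoidHom.id M + (σ : M →+ M))))) →
      Nat.card (AddMonoidHom.ker (AddMonoidHom.id M - (σ : M →+ M)) ⧸
          ((AddSubgroup.map (dbl M)
              (AddMonoidHom.ker (AddMonoidHom.id M - (σ : M →+ M)))).addSubgroupOf
            (AddMonoidHom.ker (AddMonoidHom.id M - (σ : M →+ M))))) =
        Nat.card (AddMonoidHom.ker (AddMonoidHom.id M + (σ : M →+ M)) ⧸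
          ((AddSubgroup.map (dbl M)
              (AddMonoidHom.ker (AddMonoidHom.id M + (σ : M →+ M)))).addSubgroupOf
            (AddMonoidHom.ker (AddMonoidHom.id M + (σ : M →+ M))))) →
      Nat.card (AddMonoidHom.ker (AddMonoidHom.id M - (σ : M →+ M)) ⧸
          ((AddMonoidHom.range (AddMonoidHom.id M + (σ : M →+ M))).addSubgroupOf
            (AddMonoidHom.ker (AddMonoidHom.id M - (σ : M →+ M))))) =
        Nat.card (AddMonoidHom.ker (AddMonoidHom.id M + (σ : M →+ M)) ⧸
          ((AddMonoidHom.range (AddMonoidHom.id M - (σ : M →+ M))).addSubgroupOf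
            (AddMonoidHom.ker (AddMonoidHom.id M + (σ : M →+ M)))))) := by
  obtain ⟨e, he⟩ := exists_addEquiv_range_quotient _ _ _ _ (norm_mem_dbl_fixed_iff σ)
  refine ⟨⟨e, he⟩, fun _ _ hfin _ hcard => ?_⟩
  have hN := AddSubgroup.relIndex_mul_relIndex _ _ _ (map_dbl_fixed_le_range σ)
    (range_norm_le_fixed σ hσ)
  have hD := AddSubgroup.relIndex_mul_relIndex _ _ _ (map_dbl_ker_norm_le_range σ)
    (range_sub_le_ker_norm σ hσ)
  have hrange := Nat.card_congr e.toEquiv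
  have hne := (@Nat.card_pos _ _ hfin).ne'
  simp only [AddSubgroup.relIndex, AddSubgroup.index] at hN hD
  rw [← hN] at hne
  refine Nat.eq_of_mul_eq_mul_left (Nat.pos_of_ne_zero (left_ne_zero_of_mul hne)) ?_
  rw [hN, hcard, ← hD, hrange]
end

section
/- Let G be a cyclic group of order r acting on Λ = ℤ[x]/(x^d + 1) (with d dividing r appropriately so that x^d + 1 divides x^r − 1, i.e. r = 2d·m for some m with x acting as the generator). Then H¹(G, Λ) ≅ ℤ/2ℤ. -/
open Polynomial in
theorem X_pow_add_one_dvd_geomSum (d m : ℕ) :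
    (X ^ d + 1 : ℤ[X]) ∣ ∑ i ∈ Finset.range (2 * d * m), X ^ i := by
  refine ⟨(∑ i ∈ Finset.range m, (X ^ (2 * d)) ^ i) * ∑ i ∈ Finset.range d, X ^ i, ?_⟩
  have hX : (X - 1 : ℤ[X]) ≠ 0 := by simpa using X_sub_C_ne_zero (1 : ℤ)
  apply mul_right_cancel₀ hX
  have h₁ := geom_sum_mul (X ^ (2 * d) : ℤ[X]) m
  have h₂ := geom_sum_mul (X : ℤ[X]) d
  rw [geom_sum_mul, pow_mul]
  linear_combination -h₁ - (X ^ d + 1) * (∑ i ∈ Finset.range m, (X ^ (2 * d)) ^ i) * h₂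

open Polynomial in
/-- The ring homomorphism `ℤ[x]/(p) → ℤ/p(1)ℤ` sending `x` to `1`. -/
noncomputable def evalOneModulo (p : ℤ[X]) (n : ℕ) (hp : p.eval 1 = n) :
    (ℤ[X] ⧸ Ideal.span {p}) →+* ZMod n :=
  Ideal.Quotient.lift _ ((Int.castRingHom (ZMod n)).comp (evalRingHom 1)) fun a ha => by
    obtain ⟨q, rfl⟩ := Ideal.mem_span_singleton.1 ha
    simp [hp]

open Polynomial in
theorem evalOneModulo_mk (p : ℤ[X]) (n : ℕ) (hp : p.eval 1 = n) (f : ℤ[X]) :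
    evalOneModulo p n hp (Ideal.Quotient.mk _ f) = (f.eval 1 : ℤ) := rfl

open Polynomial in
theorem evalOneModulo_eq_zero_iff (p : ℤ[X]) (n : ℕ) (hp : p.eval 1 = n)
    (a : ℤ[X] ⧸ Ideal.span {p}) :
    evalOneModulo p n hp a = 0 ↔ ∃ b, Ideal.Quotient.mk _ (X - 1) * b = a := by
  constructor
  · obtain ⟨f, rfl⟩ := Ideal.Quotient.mk_surjective a
    rw [evalOneModulo_mk, ZMod.intCast_zmod_eq_zero_iff_dvd]
    rintro ⟨k, hk⟩
    have hroot : (f - p * C k).IsRoot 1 := by simp [hk, hp]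
    obtain ⟨q, hq⟩ := dvd_iff_isRoot.2 hroot
    refine ⟨Ideal.Quotient.mk _ q, ?_⟩
    rw [← map_mul, Ideal.Quotient.mk_eq_mk_iff_sub_mem, ← C_1, ← hq, Ideal.mem_span_singleton]
    exact ⟨-C k, by ring⟩
  · rintro ⟨b, rfl⟩
    simp [map_mul, evalOneModulo_mk, -map_sub]


set_option synthInstance.maxHeartbeats 1000000 in
set_option maxHeartbeats 1000000 in
/-- Let a cyclic group of order `r = 2·d·m` act on `Λ = ℤ[x]/(x^d + 1)` by
multiplication by `x` (note `x^d + 1` divides `x^r - 1`).  Then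
`H¹ = ker(1 + x + ⋯ + x^(r-1)) / im(x - 1)` is isomorphic to `ℤ/2ℤ`. -/
theorem stmt_4 (d m : ℕ) (hd : 1 ≤ d) (hm : 1 ≤ m) :
    ∀ N D : (Polynomial ℤ ⧸ Ideal.span {(Polynomial.X ^ d + 1 : Polynomial ℤ)}) →+
        (Polynomial ℤ ⧸ Ideal.span {(Polynomial.X ^ d + 1 : Polynomial ℤ)}),
      N = AddMonoidHom.mulLeft
            (Ideal.Quotient.mk (Ideal.span {(Polynomial.X ^ d + 1 : Polynomial ℤ)})
              (∑ i ∈ Finset.range (2 * d * m), Polynomial.X ^ i)) →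
      D = AddMonoidHom.mulLeft
            (Ideal.Quotient.mk (Ideal.span {(Polynomial.X ^ d + 1 : Polynomial ℤ)})
              (Polynomial.X - 1)) →
      Nonempty ((N.ker ⧸ (D.range.addSubgroupOf N.ker)) ≃+ ZMod 2) := by
  rintro N D rfl rfl
  have heval : (Polynomial.X ^ d + 1 : Polynomial ℤ).eval 1 = (2 : ℕ) := by norm_num
  set ε := evalOneModulo (Polynomial.X ^ d + 1) 2 heval
  have hnorm := Ideal.Quotient.eq_zero_iff_mem.2
    (Ideal.mem_span_singleton.2 (X_pow_add_one_dvd_geomSum d m))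
  rw [hnorm]
  set K := (AddMonoidHom.mulLeft
    (0 : Polynomial ℤ ⧸ Ideal.span {(Polynomial.X ^ d + 1 : Polynomial ℤ)})).ker
  have hK (a) : a ∈ K := AddMonoidHom.mem_ker.2 (zero_mul a)
  let φ : K →+ ZMod 2 := ε.toAddMonoidHom.comp K.subtype
  have hφ : Function.Surjective φ := fun z => by
    obtain ⟨a, ha⟩ := ZMod.ringHom_surjective ε z
    exact ⟨⟨a, hK a⟩, ha⟩
  refine ⟨(QuotientAddGroup.quotientAddEquivOfEq ?_).trans
    (QuotientAddGroup.quotientKerEquivOfSurjective φ hφ)⟩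
  ext ⟨a, ha⟩
  exact (evalOneModulo_eq_zero_iff _ 2 heval a).symm
end

section
/- Let G be a group acting on a finite set W of size 2g + 2 (g ≥ 2), let Σ : 𝔽₂[W] → 𝔽₂ be the sum map, Δ = Σ_{w∈W} w ∈ 𝔽₂[W], and J := ker(Σ)/𝔽₂·Δ, an 𝔽₂[G]-module. Suppose G acts with n orbits on W and at least one orbit of odd size. Then dim_{𝔽₂} J^G = n − 2. -/
/-- The sum (augmentation) map `𝔽₂[W] → 𝔽₂`. -/
def sumMap (W : Type*) [Fintype W] : (W → ZMod 2) →ₗ[ZMod 2] ZMod 2 where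
  toFun f := ∑ w, f w
  map_add' f g := by simp [Finset.sum_add_distrib]
  map_smul' c f := by simp [Finset.mul_sum]

/-- The linear permutation action of `g : G` on `𝔽₂[W]`. -/
def permMap {G : Type*} [Group G] (W : Type*) [MulAction G W] (a : G) :
    (W → ZMod 2) →ₗ[ZMod 2] (W → ZMod 2) where
  toFun f := fun w => f (a⁻¹ • w)
  map_add' _ _ := rfl
  map_smul' _ _ := rfl

section PermutationModule

variable {G W : Type*} [Group G] [MulAction G W]

/-- Pulling back functions on the orbit space to functions on `W`. -/
def orbitPullback (G W : Type*) [Group G] [MulAction G W] :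
    (MulAction.orbitRel.Quotient G W → ZMod 2) →ₗ[ZMod 2] (W → ZMod 2) :=
  LinearMap.funLeft (ZMod 2) (ZMod 2) (Quotient.mk (MulAction.orbitRel G W))

theorem orbitPullback_apply (f : MulAction.orbitRel.Quotient G W → ZMod 2) (w : W) :
    orbitPullback G W f w = f (Quotient.mk (MulAction.orbitRel G W) w) := rfl

theorem orbitPullback_injective : Function.Injective (orbitPullback G W) :=
  LinearMap.funLeft_injective_of_surjective _ _ _ Quotient.mk_surjective

theorem permMap_orbitPullback (a : G) (f : MulAction.orbitRel.Quotient G W → ZMod 2) :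
    permMap W a (orbitPullback G W f) = orbitPullback G W f := by
  funext w
  exact congrArg f (Quotient.sound ⟨a⁻¹, rfl⟩)

theorem exists_orbitPullback_eq {x : W → ZMod 2} (hx : ∀ a : G, permMap W a x = x) :
    ∃ f, orbitPullback G W f = x := by
  refine ⟨Quotient.lift x ?_, rfl⟩
  rintro u v ⟨a, rfl⟩
  simpa [permMap] using congrFun (hx a⁻¹) v

variable [Fintype W]

open Classical in
theorem sum_orbit_permMap (w : W) (a : G) (x : W → ZMod 2) :
    ∑ v with v ∈ MulAction.orbit G w, permMap W a x v =
      ∑ v with v ∈ MulAction.orbit G w, x v := by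
  refine Finset.sum_equiv (MulAction.toPerm a⁻¹) (fun v => ?_) (fun v _ => rfl)
  simp only [Finset.mem_filter, Finset.mem_univ, true_and, MulAction.toPerm_apply]
  simp only [← MulAction.orbitRel_apply, ← Quotient.eq (r := MulAction.orbitRel G W)]
  rw [Quotient.sound (show MulAction.orbitRel G W (a⁻¹ • v) v from ⟨a⁻¹, rfl⟩)]

open Classical in
theorem sum_orbit_one {w : W} (hw : Odd (Nat.card (MulAction.orbit G w))) :
    ∑ v with v ∈ MulAction.orbit G w, (1 : ZMod 2) = 1 := by
  rw [Finset.sum_const, nsmul_one, ZMod.natCast_eq_one_iff_odd]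
  rwa [Nat.card_eq_fintype_card, Fintype.card_subtype] at hw

theorem permMap_eq_self_of_sub_eq {w : W} (hw : Odd (Nat.card (MulAction.orbit G w)))
    {a : G} {x : W → ZMod 2} {c : ZMod 2} (h : ∀ v, permMap W a x v - x v = c) :
    permMap W a x = x := by
  classical
  have hc : c = 0 := by
    rw [← mul_one c, ← sum_orbit_one hw, Finset.mul_sum]
    rw [Finset.sum_congr rfl fun v _ => (mul_one c).trans (h v).symm,
      Finset.sum_sub_distrib, sum_orbit_permMap, sub_self]
  funext v
  exact sub_eq_zero.1 ((h v).trans hc)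

theorem sumMap_orbitPullback_surjective {w : W}
    (hw : Odd (Nat.card (MulAction.orbit G w))) :
    Function.Surjective (sumMap W ∘ₗ orbitPullback G W) := by
  classical
  refine LinearMap.surjective fun h => one_ne_zero (α := ZMod 2) ?_
  rw [← sum_orbit_one hw]
  refine Eq.trans ?_ (LinearMap.congr_fun h
    (Pi.single (Quotient.mk (MulAction.orbitRel G W) w) 1))
  simp only [LinearMap.comp_apply, sumMap, LinearMap.coe_mk, AddHom.coe_mk,
    orbitPullback_apply, Pi.single_apply, Finset.sum_filter]
  refine Finset.sum_congr rfl fun v _ => if_congr ?_ rfl rfl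
  rw [Quotient.eq]
  rfl

theorem finrank_ker_sumMap_orbitPullback {w : W}
    (hw : Odd (Nat.card (MulAction.orbit G w))) :
    Module.finrank (ZMod 2) (LinearMap.ker (sumMap W ∘ₗ orbitPullback G W)) + 1 =
      Nat.card (MulAction.orbitRel.Quotient G W) := by
  classical
  have : Fintype (MulAction.orbitRel.Quotient G W) := Fintype.ofFinite _
  have h := LinearMap.finrank_range_add_finrank_ker (sumMap W ∘ₗ orbitPullback G W)
  rw [LinearMap.range_eq_top.2 (sumMap_orbitPullback_surjective hw), finrank_top,
    Module.finrank_self, Module.finrank_fintype_fun_eq_card] at h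
  rw [Nat.card_eq_fintype_card, ← h, add_comm]

/-- Pulling back sum-zero functions on the orbit space to the kernel of the sum map. -/
def orbitPullbackKer (G W : Type*) [Group G] [MulAction G W] [Fintype W] :
    LinearMap.ker (sumMap W ∘ₗ orbitPullback G W) →ₗ[ZMod 2] LinearMap.ker (sumMap W) :=
  (orbitPullback G W).restrict fun _ h => h

theorem orbitPullbackKer_injective : Function.Injective (orbitPullbackKer G W) :=
  fun _ _ h => Subtype.ext (orbitPullback_injective (congrArg Subtype.val h))

end PermutationModule

/-- Let `G` act on a finite set `W` of size `2g+2` (`g ≥ 2`) with at least one odd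
orbit, and let `J = ker(Σ)/𝔽₂·Δ` where `Σ : 𝔽₂[W] → 𝔽₂` is the sum map and `Δ` the
all-ones vector.  If `G` has `n` orbits on `W`, then `dim_{𝔽₂} J^G = n - 2`.
(The side hypotheses `heven`, `hker`, `hq` — that `Δ ∈ ker Σ`, that the permutation
action preserves `ker Σ`, and that it preserves the line spanned by `Δ` — are
automatic.) -/
theorem stmt_12 {G W : Type*} [Group G] [Fintype W] [MulAction G W]
    (g : ℕ) (hg : 2 ≤ g) (hcard : Fintype.card W = 2 * g + 2)
    (heven : (fun _ => (1 : ZMod 2)) ∈ LinearMap.ker (sumMap W))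
    (hker : ∀ a : G, ∀ x ∈ LinearMap.ker (sumMap W),
      permMap W a x ∈ LinearMap.ker (sumMap W))
    (hq : ∀ a : G,
      Submodule.span (ZMod 2)
          {(⟨fun _ => (1 : ZMod 2), heven⟩ : LinearMap.ker (sumMap W))} ≤
        (Submodule.span (ZMod 2)
            {(⟨fun _ => (1 : ZMod 2), heven⟩ : LinearMap.ker (sumMap W))}).comap
          ((permMap W a).restrict (hker a)))
    (hodd : ∃ w : W, Odd (Nat.card (MulAction.orbit G w))) :
    Module.finrank (ZMod 2)
        ↥(⨅ a : G, LinearMap.eqLocus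
            (Submodule.mapQ _ _ ((permMap W a).restrict (hker a)) (hq a)) LinearMap.id) =
      Nat.card (MulAction.orbitRel.Quotient G W) - 2 := by
  obtain ⟨w, hw⟩ := hodd
  set Δ : LinearMap.ker (sumMap W) := ⟨fun _ => (1 : ZMod 2), heven⟩ with hΔ
  set S := Submodule.span (ZMod 2) {Δ} with hS
  have hΔ0 : Δ ≠ 0 := fun h => one_ne_zero (congrFun (congrArg Subtype.val h) w)
  have hSle : S ≤ LinearMap.range (orbitPullbackKer G W) := by
    rw [hS, Submodule.span_singleton_le_iff_mem]
    exact ⟨⟨fun _ => 1, heven⟩, rfl⟩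
  have hker' : Module.finrank (ZMod 2)
      (LinearMap.ker (S.mkQ ∘ₗ orbitPullbackKer G W)) = 1 := by
    have hcomap : LinearMap.ker (S.mkQ ∘ₗ orbitPullbackKer G W) =
        S.comap (orbitPullbackKer G W) :=
      (LinearMap.ker_comp _ _).trans (by rw [Submodule.ker_mkQ])
    rw [hcomap,
      (Submodule.comap_equiv_self_of_inj_of_le orbitPullbackKer_injective hSle).finrank_eq]
    exact finrank_span_singleton hΔ0
  have hrange : (⨅ a : G, LinearMap.eqLocus
      (Submodule.mapQ _ _ ((permMap W a).restrict (hker a)) (hq a)) LinearMap.id) =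
      LinearMap.range (S.mkQ ∘ₗ orbitPullbackKer G W) := by
    ext y
    obtain ⟨x, rfl⟩ := S.mkQ_surjective y
    simp only [Submodule.mem_iInf, LinearMap.mem_eqLocus, LinearMap.id_apply]
    constructor
    · intro h
      obtain ⟨f, hf⟩ := exists_orbitPullback_eq (G := G) (x := x.1) fun a => by
        have ha := h a
        rw [Submodule.mkQ_apply, Submodule.mapQ_apply, Submodule.Quotient.eq,
          Submodule.mem_span_singleton] at ha
        obtain ⟨c, hc⟩ := ha
        refine permMap_eq_self_of_sub_eq hw (c := c) fun v => ?_
        have := congrFun (congrArg Subtype.val hc) v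
        simpa [hΔ] using this.symm
      refine ⟨⟨f, ?_⟩, congrArg S.mkQ (Subtype.ext hf)⟩
      rw [LinearMap.mem_ker, LinearMap.comp_apply, hf]
      exact x.2
    · rintro ⟨f, hf⟩ a
      rw [← hf, LinearMap.comp_apply, Submodule.mkQ_apply, Submodule.mapQ_apply]
      exact congrArg S.mkQ (Subtype.ext (permMap_orbitPullback a f.1))
  have h₁ := LinearMap.finrank_range_add_finrank_ker (S.mkQ ∘ₗ orbitPullbackKer G W)
  rw [hker'] at h₁
  have h₂ := (congrArg (· + 1) h₁).trans (finrank_ker_sumMap_orbitPullback hw)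
  rw [hrange, ← h₂]
  rfl
end
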